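/- arXiv:0907.4540 — 2 statements merged into one kernel-verified Lean document; each statement's English description precedes it below -/
import Mathlib

section
/- Let φ be a smooth function supported in an annulus {A₁ ≤ |ξ| ≤ A₂} with 0 < A₁ < A₂. Then there exist positive constants c and C such that for every 1 ≤ p ≤ ∞, every λ > 0, every ν > 0 and t ≥ 0, ‖φ(λ^{−1}D) e^{νtΔ} f‖_{L^p} ≤ C e^{−cνtλ²} ‖φ(λ^{−1}D) f‖_{L^p}. -/
open MeasureTheory FourierTransform ENNReal

/-- Fourier multiplier with symbol `m`. -/
noncomputable def mult7 {n : ℕ} (m : EuclideanSpace ℝ (Fin n) → ℂ)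
    (f : EuclideanSpace ℝ (Fin n) → ℂ) : EuclideanSpace ℝ (Fin n) → ℂ :=
  𝓕⁻ (fun ξ => m ξ * 𝓕 f ξ)

section aux7
open scoped Convolution SchwartzMap ContDiff

variable {n : ℕ}

theorem young7 (k g : EuclideanSpace ℝ (Fin n) → ℂ) (hk : Continuous k)
    (hg : Continuous g) (p : ℝ≥0∞) (hp : 1 ≤ p) :
    eLpNorm (k ⋆[ContinuousLinearMap.mul ℂ ℂ] g) p volume
      ≤ eLpNorm k 1 volume * eLpNorm g p volume := by
  have hpt : ∀ x, ‖(k ⋆[ContinuousLinearMap.mul ℂ ℂ] g) x‖ₑ ≤ ∫⁻ y, ‖k y‖ₑ * ‖g (x - y)‖ₑ := by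
    intro x
    refine (enorm_integral_le_lintegral_enorm _).trans (le_of_eq ?_)
    simp [enorm_mul]
  have hM : eLpNorm k 1 volume = ∫⁻ y, ‖k y‖ₑ := eLpNorm_one_eq_lintegral_enorm
  have mk : Measurable fun y => ‖k y‖ₑ := hk.enorm.measurable
  rcases eq_or_ne p ⊤ with rfl | hpt'
  · rw [eLpNorm_exponent_top, eLpNorm_exponent_top, hM]
    refine eLpNormEssSup_le_of_ae_enorm_bound (Filter.Eventually.of_forall fun x => ?_)
    refine (hpt x).trans ?_
    rw [← lintegral_mul_const _ mk]
    refine lintegral_mono_ae ?_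
    have h1 := (Measure.measurePreserving_sub_left (volume : Measure (EuclideanSpace ℝ (Fin n))) x).quasiMeasurePreserving.ae
      (ae_le_eLpNormEssSup (f := g) (μ := volume))
    filter_upwards [h1] with y hy
    gcongr
  · set q := p.toReal with hq
    have hq1 : 1 ≤ q := by
      rw [hq, ← ENNReal.toReal_one]; exact (ENNReal.toReal_le_toReal (by simp) hpt').2 hp
    have hq0 : 0 < q := by linarith
    have hp0 : p ≠ 0 := by rintro rfl; simp at hp
    rw [eLpNorm_eq_lintegral_rpow_enorm_toReal hp0 hpt', eLpNorm_eq_lintegral_rpow_enorm_toReal hp0 hpt', hM, ← hq]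
    set M := ∫⁻ y, ‖k y‖ₑ with hMdef
    have key : ∫⁻ x, ‖(k ⋆[ContinuousLinearMap.mul ℂ ℂ] g) x‖ₑ ^ q ≤ M ^ q * ∫⁻ x, ‖g x‖ₑ ^ q := by
      have h1 : ∀ x, ‖(k ⋆[ContinuousLinearMap.mul ℂ ℂ] g) x‖ₑ ^ q
          ≤ (∫⁻ y, ‖k y‖ₑ * ‖g (x - y)‖ₑ ^ q) * M ^ (q - 1) := by
        intro x
        have mg : Measurable fun y => ‖g (x - y)‖ₑ :=
          (hg.comp (continuous_const.sub continuous_id)).enorm.measurable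
        have h2 := eLpNorm'_le_eLpNorm'_mul_rpow_measure_univ
          (μ := volume.withDensity fun y => ‖k y‖ₑ) (f := fun y => g (x - y)) (p := 1) (q := q)
          one_pos hq1 (by
            exact (hg.comp (continuous_const.sub continuous_id)).aestronglyMeasurable)
        simp only [eLpNorm', ENNReal.rpow_one, div_one] at h2
        rw [lintegral_withDensity_eq_lintegral_mul _ mk mg,
          lintegral_withDensity_eq_lintegral_mul _ mk (mg.pow_const q),
          withDensity_apply _ MeasurableSet.univ, Measure.restrict_univ, ← hMdef] at h2
        calc _ ≤ (∫⁻ y, ‖k y‖ₑ * ‖g (x - y)‖ₑ) ^ q := by gcongr; exact hpt x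
          _ ≤ _ := ENNReal.rpow_le_rpow h2 hq0.le
          _ = _ := by
            rw [ENNReal.mul_rpow_of_nonneg _ _ hq0.le, ← ENNReal.rpow_mul, ← ENNReal.rpow_mul]
            have e1 : 1 / q * q = 1 := by field_simp
            have e2 : (1 - 1 / q) * q = q - 1 := by field_simp
            rw [e1, e2, ENNReal.rpow_one]; rfl
      have mm : Measurable fun z : EuclideanSpace ℝ (Fin n) × EuclideanSpace ℝ (Fin n) =>
          ‖k z.2‖ₑ * ‖g (z.1 - z.2)‖ₑ ^ q := by
        refine Measurable.mul (mk.comp measurable_snd) (Measurable.pow_const ?_ q)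
        exact (hg.comp (continuous_fst.sub continuous_snd)).enorm.measurable
      calc _ ≤ ∫⁻ x, (∫⁻ y, ‖k y‖ₑ * ‖g (x - y)‖ₑ ^ q) * M ^ (q - 1) := lintegral_mono h1
        _ = (∫⁻ x, (∫⁻ y, ‖k y‖ₑ * ‖g (x - y)‖ₑ ^ q)) * M ^ (q - 1) :=
            lintegral_mul_const _ mm.lintegral_prod_right'
        _ = (∫⁻ y, (∫⁻ x, ‖k y‖ₑ * ‖g (x - y)‖ₑ ^ q)) * M ^ (q - 1) := by
            rw [lintegral_lintegral_swap mm.aemeasurable]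
        _ = (∫⁻ y, ‖k y‖ₑ * (∫⁻ x, ‖g x‖ₑ ^ q)) * M ^ (q - 1) := by
            congr 2; ext y
            have m3 : Measurable fun x => ‖g (x - y)‖ₑ ^ q := Measurable.pow_const
              (hg.comp (continuous_id.sub continuous_const)).enorm.measurable q
            rw [lintegral_const_mul _ m3]
            rw [lintegral_sub_right_eq_self (fun x => ‖g x‖ₑ ^ q) y]
        _ = M ^ q * ∫⁻ x, ‖g x‖ₑ ^ q := by
            rw [lintegral_mul_const _ mk, ← hMdef]
            have : M ^ q = M * M ^ (q - 1) := by
              conv_rhs => enter [1]; rw [← ENNReal.rpow_one M]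
              rw [← ENNReal.rpow_add_of_nonneg _ _ (by norm_num) (by linarith)]
              congr 1; ring
            rw [this]; ring
    calc _ ≤ (M ^ q * ∫⁻ x, ‖g x‖ₑ ^ q) ^ (1 / q) := ENNReal.rpow_le_rpow key (by positivity)
      _ = _ := by
        rw [ENNReal.mul_rpow_of_nonneg _ _ (by positivity), ← ENNReal.rpow_mul]
        have e1 : q * (1 / q) = 1 := by field_simp
        rw [e1, ENNReal.rpow_one]

/-- the L1 norm of the kernel -/
noncomputable def ker7 (m : 𝓢(EuclideanSpace ℝ (Fin n), ℂ)) : ℝ≥0∞ :=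
  eLpNorm (𝓕⁻ (m : EuclideanSpace ℝ (Fin n) → ℂ)) 1 volume

theorem ker7_ne_top (m : 𝓢(EuclideanSpace ℝ (Fin n), ℂ)) : ker7 m ≠ ⊤ := by
  rw [ker7, ← SchwartzMap.fourierInv_coe]
  exact ((𝓕⁻ m).memLp 1 volume).2.ne

theorem scale7 (m : EuclideanSpace ℝ (Fin n) → ℂ) (hm : Continuous (𝓕⁻ m)) (a : ℝ) (ha : 0 < a) :
    eLpNorm (𝓕⁻ (fun ξ => m (a • ξ))) 1 volume = eLpNorm (𝓕⁻ m) 1 volume := by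
  have h : ∀ x, 𝓕⁻ (fun ξ => m (a • ξ)) x = ((a ^ n)⁻¹ : ℝ) • 𝓕⁻ m (a⁻¹ • x) := by
    intro x
    rw [Real.fourierInv_eq, Real.fourierInv_eq]
    have := Measure.integral_comp_smul_of_nonneg (volume : Measure (EuclideanSpace ℝ (Fin n)))
      (fun v => Real.fourierChar (inner ℝ v (a⁻¹ • x)) • m v) a (hR := ha.le)
    simp only [finrank_euclideanSpace, Fintype.card_fin] at this
    rw [← this]
    congr 1; ext v
    have e : inner ℝ (a • v) (a⁻¹ • x) = inner ℝ v x := by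
      rw [inner_smul_left, inner_smul_right]; simp; field_simp
    rw [e]
  rw [eLpNorm_one_eq_lintegral_enorm, eLpNorm_one_eq_lintegral_enorm]
  simp_rw [h, enorm_smul]
  have mm : Measurable fun x => ‖𝓕⁻ m x‖ₑ := hm.enorm.measurable
  have m2 : Measurable fun x => ‖𝓕⁻ m (a⁻¹ • x)‖ₑ := mm.comp (measurable_const_smul _)
  rw [lintegral_const_mul _ m2]
  have h2 := lintegral_map mm (measurable_const_smul (a⁻¹)) (μ := (volume : Measure (EuclideanSpace ℝ (Fin n))))
  rw [← h2, Measure.map_addHaar_smul _ (by positivity), lintegral_smul_measure]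
  simp only [finrank_euclideanSpace, Fintype.card_fin, smul_eq_mul]
  rw [← mul_assoc, Real.enorm_eq_ofReal (by positivity), ← ENNReal.ofReal_mul (by positivity), abs_of_pos (by positivity)]
  have : (a ^ n)⁻¹ * ((a⁻¹) ^ n)⁻¹ = 1 := by rw [inv_pow, inv_inv]; field_simp
  rw [this]; simp

theorem mulA7 (m g : 𝓢(EuclideanSpace ℝ (Fin n), ℂ)) (a : ℝ) (ha : 0 < a) :
    ∃ h : 𝓢(EuclideanSpace ℝ (Fin n), ℂ), (∀ ξ, 𝓕 h ξ = m (a • ξ) * 𝓕 g ξ) ∧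
      ∀ p : ℝ≥0∞, 1 ≤ p → eLpNorm h p volume ≤ ker7 m * eLpNorm g p volume := by
  let L : EuclideanSpace ℝ (Fin n) ≃L[ℝ] EuclideanSpace ℝ (Fin n) :=
    ContinuousLinearEquiv.smulLeft (Units.mk0 a ha.ne')
  let ma : 𝓢(EuclideanSpace ℝ (Fin n), ℂ) := SchwartzMap.compCLMOfContinuousLinearEquiv ℂ L m
  have hma : (ma : EuclideanSpace ℝ (Fin n) → ℂ) = fun ξ => m (a • ξ) := rfl
  refine ⟨SchwartzMap.convolution (ContinuousLinearMap.mul ℂ ℂ) (𝓕⁻ ma) g, ?_, ?_⟩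
  · intro ξ
    rw [SchwartzMap.fourier_convolution]
    simp [hma]
  · intro p hp
    have e : (SchwartzMap.convolution (ContinuousLinearMap.mul ℂ ℂ) (𝓕⁻ ma) g : EuclideanSpace ℝ (Fin n) → ℂ)
        = ((𝓕⁻ ma : 𝓢(EuclideanSpace ℝ (Fin n), ℂ)) ⋆[ContinuousLinearMap.mul ℂ ℂ] g) := by
      ext x; exact SchwartzMap.convolution_apply _ _ _ _
    rw [e]
    refine (young7 _ _ (𝓕⁻ ma).continuous g.continuous p hp).trans (le_of_eq ?_)
    rw [SchwartzMap.fourierInv_coe, hma, scale7 _ _ a ha, ker7]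
    rw [← SchwartzMap.fourierInv_coe]
    exact (𝓕⁻ m).continuous

theorem gauss7 : ∃ G : 𝓢(EuclideanSpace ℝ (Fin n), ℂ), ∀ ξ, G ξ = Complex.exp (-(‖ξ‖ ^ 2 : ℝ)) := by
  have hE : ContDiff ℝ ∞ (fun u : ℝ => Real.exp (-u)) := by fun_prop
  have hN : ContDiff ℝ ∞ (fun x : EuclideanSpace ℝ (Fin n) => ‖x‖ ^ 2) := contDiff_id.norm_sq ℝ
  let G0 : 𝓢(EuclideanSpace ℝ (Fin n), ℝ) :=
    { toFun := (fun u : ℝ => Real.exp (-u)) ∘ (fun x => ‖x‖ ^ 2)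
      smooth' := hE.comp hN
      decay' := by
        intro k l
        obtain ⟨j, C, hC, hb⟩ := (Function.hasTemperateGrowth_norm_sq
          (H := EuclideanSpace ℝ (Fin n))).norm_iteratedFDeriv_le_uniform l
        have hexp : ∃ B : ℝ, ∀ r : ℝ, 0 ≤ r → (1 + r) ^ (k + j * l) * Real.exp (-r ^ 2) ≤ B := by
          set N := k + j * l
          refine ⟨(N.factorial : ℝ) * Real.exp 2, fun r hr => ?_⟩
          have h1 := Real.pow_div_factorial_le_exp (1 + r) (by linarith) N
          have h2 : (1 + r) ^ N ≤ N.factorial * Real.exp (1 + r) := by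
            rw [div_le_iff₀ (by positivity)] at h1; linarith
          calc _ ≤ (N.factorial * Real.exp (1 + r)) * Real.exp (-r ^ 2) := by gcongr
            _ = N.factorial * Real.exp (1 + r - r ^ 2) := by
              rw [mul_assoc, ← Real.exp_add]; ring_nf
            _ ≤ _ := by
              gcongr; nlinarith [sq_nonneg (r - 1/2)]
        obtain ⟨B, hB⟩ := hexp
        refine ⟨(l.factorial : ℝ) * (1 + C) ^ l * B, fun x => ?_⟩
        have hD : ∀ i, 1 ≤ i → i ≤ l →
            ‖iteratedFDeriv ℝ i (fun x : EuclideanSpace ℝ (Fin n) => ‖x‖ ^ 2) x‖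
              ≤ ((1 + C) * (1 + ‖x‖) ^ j) ^ i := by
          intro i hi hil
          have h1 : (1:ℝ) ≤ (1 + C) * (1 + ‖x‖) ^ j :=
            one_le_mul_of_one_le_of_one_le (by linarith)
              (one_le_pow₀ (by linarith [norm_nonneg x]))
          calc _ ≤ C * (1 + ‖x‖) ^ j := hb i hil x
            _ ≤ (1 + C) * (1 + ‖x‖) ^ j := by gcongr; linarith
            _ ≤ _ := le_self_pow₀ h1 (by omega)
        have hCC : ∀ i, i ≤ l → ‖iteratedFDeriv ℝ i (fun u : ℝ => Real.exp (-u)) (‖x‖ ^ 2)‖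
            ≤ Real.exp (-‖x‖ ^ 2) := by
          intro i _
          rw [norm_iteratedFDeriv_eq_norm_iteratedDeriv]
          have := iteratedDeriv_comp_neg i Real.exp (‖x‖ ^ 2)
          rw [this]
          simp [iteratedDeriv_eq_iterate, Real.iter_deriv_exp]
        have := norm_iteratedFDeriv_comp_le hE hN (n := l) (by exact_mod_cast le_top) x hCC hD
        calc _ ≤ (1 + ‖x‖) ^ k * (l.factorial * Real.exp (-‖x‖ ^ 2) * ((1 + C) * (1 + ‖x‖) ^ j) ^ l) := by
              gcongr; linarith
          _ = l.factorial * (1 + C) ^ l * ((1 + ‖x‖) ^ (k + j * l) * Real.exp (-‖x‖ ^ 2)) := by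
              rw [mul_pow, pow_add, pow_mul]; ring
          _ ≤ _ := by gcongr; exact hB _ (norm_nonneg x) }
  refine ⟨SchwartzMap.postcompCLM (𝕜 := ℝ) Complex.ofRealCLM G0, fun ξ => ?_⟩
  rw [SchwartzMap.postcompCLM_apply]
  change ((Real.exp (-‖ξ‖ ^ 2) : ℝ) : ℂ) = _
  push_cast; ring_nf

theorem eta7 (A₁ A₂ : ℝ) (h₁ : 0 < A₁) (h₁₂ : A₁ < A₂) :
    ∃ η : 𝓢(EuclideanSpace ℝ (Fin n), ℂ), ∀ ξ, A₁ ≤ ‖ξ‖ → ‖ξ‖ ≤ A₂ →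
      η ξ * ((‖ξ‖ ^ 2 : ℝ) : ℂ) = 1 := by
  let b₁ : ContDiffBump (0 : EuclideanSpace ℝ (Fin n)) := ⟨A₁ / 2, A₁, by linarith, by linarith⟩
  let b₂ : ContDiffBump (0 : EuclideanSpace ℝ (Fin n)) := ⟨A₂, 2 * A₂, by linarith, by linarith⟩
  have hN : ContDiff ℝ ∞ (fun x : EuclideanSpace ℝ (Fin n) => ‖x‖ ^ 2) := contDiff_id.norm_sq ℝ
  have hpos : ∀ x : EuclideanSpace ℝ (Fin n), ‖x‖ ^ 2 + b₁ x ≠ 0 := by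
    intro x
    rcases eq_or_ne x 0 with rfl | hx
    · have : b₁ 0 = 1 := b₁.one_of_mem_closedBall (by simp [b₁]; linarith)
      simp [this]
    · have := b₁.nonneg (x := x)
      have : 0 < ‖x‖ := norm_pos_iff.2 hx
      positivity
  have hc : ContDiff ℝ ∞ (fun x => b₂ x / (‖x‖ ^ 2 + b₁ x)) :=
    b₂.contDiff.div (hN.add b₁.contDiff) hpos
  have hs : HasCompactSupport (fun x => b₂ x / (‖x‖ ^ 2 + b₁ x)) := by
    simp_rw [div_eq_mul_inv]
    exact b₂.hasCompactSupport.mul_right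
  refine ⟨SchwartzMap.postcompCLM (𝕜 := ℝ) Complex.ofRealCLM (hs.toSchwartzMap hc), fun ξ h h' => ?_⟩
  rw [SchwartzMap.postcompCLM_apply]
  change ((b₂ ξ / (‖ξ‖ ^ 2 + b₁ ξ) : ℝ) : ℂ) * _ = 1
  have e1 : b₁ ξ = 0 := b₁.zero_of_le_dist (by simpa [b₁] using h)
  have e2 : b₂ ξ = 1 := b₂.one_of_mem_closedBall (by simpa [b₂] using h')
  have : 0 < ‖ξ‖ := by linarith
  rw [e1, e2, ← Complex.ofReal_mul, add_zero, one_div, inv_mul_cancel₀ (by positivity)]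
  simp

theorem heat7 (n : ℕ) : ∃ K : ℝ, 0 < K ∧ ∀ r : ℝ, 0 ≤ r → ∀ g : 𝓢(EuclideanSpace ℝ (Fin n), ℂ),
    ∃ h : 𝓢(EuclideanSpace ℝ (Fin n), ℂ),
      (∀ ξ, 𝓕 h ξ = Complex.exp (-(r * ‖ξ‖ ^ 2 : ℝ)) * 𝓕 g ξ) ∧
      ∀ p : ℝ≥0∞, 1 ≤ p → eLpNorm h p volume ≤ ENNReal.ofReal K * eLpNorm g p volume := by
  obtain ⟨G, hG⟩ := gauss7 (n := n)
  refine ⟨max 1 (ker7 G).toReal, by positivity, fun r hr g => ?_⟩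
  rcases hr.eq_or_lt with rfl | hr
  · refine ⟨g, by simp, fun p hp => ?_⟩
    refine le_mul_of_one_le_left (by simp) ?_
    rw [ENNReal.one_le_ofReal]; exact le_max_left _ _
  · obtain ⟨h, h1, h2⟩ := mulA7 G g (Real.sqrt r) (Real.sqrt_pos.2 hr)
    refine ⟨h, fun ξ => ?_, fun p hp => (h2 p hp).trans ?_⟩
    · rw [h1, hG, norm_smul, mul_pow, Real.norm_eq_abs, sq_abs, Real.sq_sqrt hr.le]
    · gcongr
      exact (ENNReal.ofReal_toReal (ker7_ne_top G)).symm.le.trans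
        (ENNReal.ofReal_le_ofReal (le_max_right _ _))

theorem step7 (n : ℕ) (A₁ A₂ : ℝ) (h₁ : 0 < A₁) (h₁₂ : A₁ < A₂) :
    ∃ s : ℝ, 0 < s ∧ ∀ lam : ℝ, 0 < lam → ∀ g : 𝓢(EuclideanSpace ℝ (Fin n), ℂ),
    (∀ ξ, 𝓕 g ξ ≠ 0 → A₁ ≤ ‖lam⁻¹ • ξ‖ ∧ ‖lam⁻¹ • ξ‖ ≤ A₂) →
    ∃ h : 𝓢(EuclideanSpace ℝ (Fin n), ℂ),
      (∀ ξ, 𝓕 h ξ = Complex.exp (-(s * ‖lam⁻¹ • ξ‖ ^ 2 : ℝ)) * 𝓕 g ξ) ∧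
      ∀ p : ℝ≥0∞, 1 ≤ p → eLpNorm h p volume ≤ ENNReal.ofReal (1 / 2) * eLpNorm g p volume := by
  obtain ⟨G, hG⟩ := gauss7 (n := n)
  obtain ⟨η, hη⟩ := eta7 (n := n) A₁ A₂ h₁ h₁₂
  let N : EuclideanSpace ℝ (Fin n) → ℝ := fun x => ‖x‖ ^ 2
  let H := SchwartzMap.smulLeftCLM ℂ N G
  have hH : ∀ ξ, H ξ = ((‖ξ‖ ^ 2 : ℝ) : ℂ) * Complex.exp (-(‖ξ‖ ^ 2 : ℝ)) := by
    intro ξ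
    rw [SchwartzMap.smulLeftCLM_apply_apply (Function.hasTemperateGrowth_norm_sq _), hG]
    simp
  set K := (ker7 H * ker7 η).toReal with hK
  have hK0 : 0 ≤ K := ENNReal.toReal_nonneg
  have hKe : ker7 H * ker7 η = ENNReal.ofReal K :=
    (ENNReal.ofReal_toReal (ENNReal.mul_ne_top (ker7_ne_top H) (ker7_ne_top η))).symm
  set R := 2 * K + 1 with hR
  have hR0 : 0 < R := by positivity
  refine ⟨R ^ 2, by positivity, fun lam hlam g hg => ?_⟩
  obtain ⟨u, u1, u2⟩ := mulA7 η g lam⁻¹ (by positivity)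
  obtain ⟨v, v1, v2⟩ := mulA7 H u (R * lam⁻¹) (by positivity)
  refine ⟨(((R ^ 2)⁻¹ : ℝ) : ℂ) • v, fun ξ => ?_, fun p hp => ?_⟩
  · rw [FourierTransform.fourier_smul, smul_apply, v1, u1, hH, mul_smul, norm_smul R,
      mul_pow, Real.norm_eq_abs, sq_abs]
    by_cases h0 : 𝓕 g ξ = 0
    · simp [h0]
    · obtain ⟨a1, a2⟩ := hg ξ h0
      have := hη _ a1 a2
      have hRc : (R : ℂ) ≠ 0 := by exact_mod_cast hR0.ne'
      set X := Complex.exp (-((R ^ 2 * ‖lam⁻¹ • ξ‖ ^ 2 : ℝ) : ℂ)) with hX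
      rw [Complex.ofReal_mul, smul_eq_mul, Complex.ofReal_inv, Complex.ofReal_pow]
      calc _ = ((R : ℂ) ^ 2)⁻¹ * (R : ℂ) ^ 2 * (η (lam⁻¹ • ξ) * ((‖lam⁻¹ • ξ‖ ^ 2 : ℝ) : ℂ)) * X * 𝓕 g ξ := by ring
        _ = _ := by rw [this, inv_mul_cancel₀ (by positivity)]; ring
  · have e : ((((R ^ 2)⁻¹ : ℝ) : ℂ) • v : 𝓢(EuclideanSpace ℝ (Fin n), ℂ)) = ((((R ^ 2)⁻¹ : ℝ) : ℂ) • (v : EuclideanSpace ℝ (Fin n) → ℂ)) := rfl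
    rw [e, eLpNorm_const_smul]
    have e2 : ‖(((R ^ 2)⁻¹ : ℝ) : ℂ)‖ₑ = ENNReal.ofReal (R ^ 2)⁻¹ := by
      rw [← ofReal_norm, Complex.norm_real, Real.norm_of_nonneg (by positivity)]
    rw [e2]
    calc _ ≤ ENNReal.ofReal (R ^ 2)⁻¹ * (ker7 H * (ker7 η * eLpNorm g p volume)) := by
          gcongr; exact (v2 p hp).trans (by gcongr; exact u2 p hp)
      _ = ENNReal.ofReal ((R ^ 2)⁻¹ * K) * eLpNorm g p volume := by
          rw [← mul_assoc (ker7 H), hKe, ENNReal.ofReal_mul (by positivity), mul_assoc]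
      _ ≤ _ := by
          gcongr
          rw [inv_mul_le_iff₀ (by positivity)]
          nlinarith

theorem iter7 (n : ℕ) (A₁ A₂ : ℝ) (h₁ : 0 < A₁) (h₁₂ : A₁ < A₂) :
    ∃ s : ℝ, 0 < s ∧ ∀ lam : ℝ, 0 < lam → ∀ g : 𝓢(EuclideanSpace ℝ (Fin n), ℂ),
    (∀ ξ, 𝓕 g ξ ≠ 0 → A₁ ≤ ‖lam⁻¹ • ξ‖ ∧ ‖lam⁻¹ • ξ‖ ≤ A₂) → ∀ k : ℕ,
    ∃ h : 𝓢(EuclideanSpace ℝ (Fin n), ℂ),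
      (∀ ξ, 𝓕 h ξ = Complex.exp (-((k * s) * ‖lam⁻¹ • ξ‖ ^ 2 : ℝ)) * 𝓕 g ξ) ∧
      ∀ p : ℝ≥0∞, 1 ≤ p →
        eLpNorm h p volume ≤ ENNReal.ofReal ((1 / 2) ^ k) * eLpNorm g p volume := by
  obtain ⟨s, hs, H⟩ := step7 n A₁ A₂ h₁ h₁₂
  refine ⟨s, hs, fun lam hlam g hg k => ?_⟩
  induction k with
  | zero => exact ⟨g, by simp, by simp⟩
  | succ k ih =>
    obtain ⟨u, u1, u2⟩ := ih
    obtain ⟨v, v1, v2⟩ := H lam hlam u (fun ξ hξ => hg ξ fun h0 => hξ (by rw [u1, h0, mul_zero]))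
    refine ⟨v, fun ξ => ?_, fun p hp => ?_⟩
    · rw [v1, u1, ← mul_assoc, ← Complex.exp_add]
      congr 2; push_cast; ring
    · calc _ ≤ ENNReal.ofReal (1 / 2) * (ENNReal.ofReal ((1 / 2) ^ k) * eLpNorm g p volume) :=
            (v2 p hp).trans (by gcongr; exact u2 p hp)
        _ = _ := by
          rw [← mul_assoc, ← ENNReal.ofReal_mul (by norm_num), pow_succ']

end aux7

theorem mult7_eq {n : ℕ} (m : EuclideanSpace ℝ (Fin n) → ℂ)
    (f h : SchwartzMap (EuclideanSpace ℝ (Fin n)) ℂ) (H : ∀ ξ, 𝓕 h ξ = m ξ * 𝓕 f ξ) :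
    mult7 m f = h := by
  have e : (fun ξ => m ξ * 𝓕 (f : EuclideanSpace ℝ (Fin n) → ℂ) ξ) = (𝓕 h : SchwartzMap (EuclideanSpace ℝ (Fin n)) ℂ) := by
    ext ξ; rw [H]; rfl
  rw [mult7, e, ← SchwartzMap.fourierInv_coe, FourierTransform.fourierInv_fourier_eq]

/-- for `φ` smooth supported in an annulus `{A₁ ≤ |ξ| ≤ A₂}`, there
exist `c, C > 0` such that for all `1 ≤ p ≤ ∞`, `λ > 0`, `ν > 0`, `t ≥ 0`,
`‖φ(λ⁻¹D)e^{νtΔ}f‖_{L^p} ≤ C e^{−cνtλ²}‖φ(λ⁻¹D)f‖_{L^p}`, where `e^{νtΔ}` is the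
Fourier multiplier with symbol `exp(−νt|ξ|²)`. -/
theorem statement7 {n : ℕ} (A₁ A₂ : ℝ) (h₁ : 0 < A₁) (h₁₂ : A₁ < A₂)
    (φ : EuclideanSpace ℝ (Fin n) → ℂ) (hφ : ContDiff ℝ (⊤ : ℕ∞) φ)
    (hsupp : tsupport φ ⊆ {ξ | A₁ ≤ ‖ξ‖ ∧ ‖ξ‖ ≤ A₂}) :
    ∃ c C : ℝ, 0 < c ∧ 0 < C ∧
      ∀ (p : ℝ≥0∞), 1 ≤ p →
      ∀ (lam ν t : ℝ), 0 < lam → 0 < ν → 0 ≤ t →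
      ∀ f : SchwartzMap (EuclideanSpace ℝ (Fin n)) ℂ,
        eLpNorm
          (mult7 (fun ξ => φ (lam⁻¹ • ξ))
            (mult7 (fun ξ => Complex.exp (-(ν * t * ‖ξ‖^2 : ℝ))) f)) p volume
        ≤ ENNReal.ofReal (C * Real.exp (-c * ν * t * lam^2))
          * eLpNorm (mult7 (fun ξ => φ (lam⁻¹ • ξ)) f) p volume := by
  have hcs : HasCompactSupport φ := by
    refine HasCompactSupport.of_support_subset_isCompact
      (isCompact_closedBall (0 : EuclideanSpace ℝ (Fin n)) A₂) fun x hx => ?_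
    simpa using (hsupp (subset_tsupport _ hx)).2
  let Φ := hcs.toSchwartzMap hφ
  have hΦ : ∀ ξ, Φ ξ = φ ξ := fun _ => rfl
  obtain ⟨K, hK, heat⟩ := heat7 n
  obtain ⟨s, hs, iter⟩ := iter7 n A₁ A₂ h₁ h₁₂
  refine ⟨Real.log 2 / s, 2 * K, div_pos (Real.log_pos (by norm_num)) hs, by positivity, ?_⟩
  intro p hp lam ν t hlam hν ht f
  obtain ⟨F, hF, -⟩ := heat (ν * t) (by positivity) f
  rw [mult7_eq _ f F hF]
  obtain ⟨g, hg, -⟩ := mulA7 Φ f lam⁻¹ (by positivity)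
  rw [mult7_eq (fun ξ => φ (lam⁻¹ • ξ)) f g hg]
  have hgs : ∀ ξ, 𝓕 g ξ ≠ 0 → A₁ ≤ ‖lam⁻¹ • ξ‖ ∧ ‖lam⁻¹ • ξ‖ ≤ A₂ := by
    intro ξ h
    refine hsupp (subset_tsupport _ fun h0 => h ?_)
    rw [hg, hΦ, h0, zero_mul]
  set S := ν * t * lam ^ 2 with hS
  have hS0 : 0 ≤ S := by positivity
  set k := ⌊S / s⌋₊ with hk
  have hk1 : (k : ℝ) * s ≤ S := by
    rw [← le_div_iff₀ hs]; exact Nat.floor_le (by positivity)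
  have hk2 : S / s < k + 1 := Nat.lt_floor_add_one _
  obtain ⟨u, u1, u2⟩ := iter lam hlam g hgs k
  obtain ⟨v, v1, v2⟩ := heat ((S - k * s) / lam ^ 2) (div_nonneg (by linarith) (by positivity)) u
  have hv : ∀ ξ, 𝓕 v ξ = φ (lam⁻¹ • ξ) * 𝓕 F ξ := by
    intro ξ
    rw [v1, u1, hg, hF, hΦ, ← mul_assoc, ← Complex.exp_add, norm_smul, mul_pow, Real.norm_eq_abs, sq_abs]
    have : (-(((S - k * s) / lam ^ 2 * ‖ξ‖ ^ 2 : ℝ) : ℂ) + -((k * s * (lam⁻¹ ^ 2 * ‖ξ‖ ^ 2) : ℝ) : ℂ))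
        = -((ν * t * ‖ξ‖ ^ 2 : ℝ) : ℂ) := by
      rw [← Complex.ofReal_neg, ← Complex.ofReal_neg, ← Complex.ofReal_neg, ← Complex.ofReal_add]
      congr 1; rw [hS]; field_simp; ring
    rw [this]; ring
  rw [mult7_eq _ F v hv]
  calc eLpNorm v p volume ≤ ENNReal.ofReal K * (ENNReal.ofReal ((1 / 2) ^ k) * eLpNorm g p volume) :=
        (v2 p hp).trans (by gcongr; exact u2 p hp)
    _ = ENNReal.ofReal (K * (1 / 2) ^ k) * eLpNorm g p volume := by
        rw [ENNReal.ofReal_mul hK.le, mul_assoc]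
    _ ≤ _ := by
        refine mul_le_mul' (ENNReal.ofReal_le_ofReal ?_) le_rfl
        have e1 : ((1:ℝ) / 2) ^ k = Real.exp (-(Real.log 2) * k) := by
          rw [mul_comm, Real.exp_nat_mul, Real.exp_neg, Real.exp_log (by norm_num)]; norm_num
        have e2 : (2:ℝ) = Real.exp (Real.log 2) := (Real.exp_log (by norm_num)).symm
        calc K * (1 / 2) ^ k = K * Real.exp (-(Real.log 2) * k) := by rw [e1]
          _ ≤ K * Real.exp (Real.log 2 + -(Real.log 2 / s) * ν * t * lam ^ 2) := by
            gcongr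
            have hl : 0 < Real.log 2 := Real.log_pos (by norm_num)
            have e3 : Real.log 2 + -(Real.log 2 / s) * ν * t * lam ^ 2 = Real.log 2 * (1 - S / s) := by
              rw [hS]; ring
            rw [e3]; nlinarith
          _ = _ := by rw [Real.exp_add, Real.exp_log (by norm_num)]; ring
end

section
/- High-frequency expansion of the Green matrix: there exist R, ϑ > 0 depending on ν̄ such that for |ξ| ≥ R the Fourier-transformed Green matrix admits the decomposition 𝒢̂(ξ,t) = e^{−t/ν̄}·diag(1,0) + e^{−ν̄|ξ|²t}·diag(0,1) + 𝒢̂¹(ξ,t)·[[0,1],[1,0]] + 𝒢̂²(ξ,t)·diag entries, where the scalar function 𝒢̂¹ and matrix 𝒢̂² satisfy, for every multi-index α, |∂^α_ξ 𝒢̂¹(ξ,t)| ≤ C|ξ|^{−|α|−1}(e^{−t/(2ν̄)} + e^{−ϑ|ξ|²t}) and |∂^α_ξ 𝒢̂²(ξ,t)| ≤ C|ξ|^{−|α|−2}(e^{−t/(2ν̄)} + e^{−ϑ|ξ|²t}). -/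
open Complex MeasureTheory

noncomputable section

/-- Complex square root of the discriminant `ν̄²|ξ|⁴ − 4|ξ|²`. -/
def sdisc15 {n : ℕ} (ν : ℝ) (ξ : EuclideanSpace ℝ (Fin n)) : ℂ :=
  (((ν^2 * ‖ξ‖^4 - 4 * ‖ξ‖^2 : ℝ) : ℂ)) ^ (1/2 : ℂ)

def lamP15 {n : ℕ} (ν : ℝ) (ξ : EuclideanSpace ℝ (Fin n)) : ℂ :=
  -(1/2 : ℂ) * (ν : ℂ) * (‖ξ‖ : ℂ)^2 + (1/2 : ℂ) * sdisc15 ν ξ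

def lamM15 {n : ℕ} (ν : ℝ) (ξ : EuclideanSpace ℝ (Fin n)) : ℂ :=
  -(1/2 : ℂ) * (ν : ℂ) * (‖ξ‖ : ℂ)^2 - (1/2 : ℂ) * sdisc15 ν ξ

/-- The Fourier-side Green matrix `𝒢̂(ξ,t)` of the linearized system. -/
def Ghat15 {n : ℕ} (ν : ℝ) (ξ : EuclideanSpace ℝ (Fin n)) (t : ℝ) :
    Matrix (Fin 2) (Fin 2) ℂ :=
  let lp := lamP15 ν ξ; let lm := lamM15 ν ξ
  !![(lp * exp (lm * t) - lm * exp (lp * t)) / (lp - lm),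
     -((exp (lp * t) - exp (lm * t)) / (lp - lm)) * (‖ξ‖ : ℂ);
     -((exp (lp * t) - exp (lm * t)) / (lp - lm)) * (‖ξ‖ : ℂ),
     (lp * exp (lp * t) - lm * exp (lm * t)) / (lp - lm)]

def pderiv15 {n : ℕ} (i : Fin n) (f : EuclideanSpace ℝ (Fin n) → ℂ) :
    EuclideanSpace ℝ (Fin n) → ℂ :=
  fun x => fderiv ℝ f x (EuclideanSpace.single i 1)

/-- Iterated partial derivative `∂^α_ξ`. -/
def mderiv15 {n : ℕ} (α : Fin n → ℕ) (f : EuclideanSpace ℝ (Fin n) → ℂ) :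
    EuclideanSpace ℝ (Fin n) → ℂ :=
  (List.finRange n).foldr (fun i g => (pderiv15 i)^[α i] g) f

end

section helpers

variable {n : ℕ}

def Bd15 (R : ℝ) (m : ℤ) (w : EuclideanSpace ℝ (Fin n) → ℝ → ℝ)
    (f : EuclideanSpace ℝ (Fin n) → ℝ → ℂ) : Prop :=
  ∃ C : ℝ, 0 ≤ C ∧ ∀ ξ t, R < ‖ξ‖ → 0 ≤ t → ‖f ξ t‖ ≤ C * ‖ξ‖ ^ m * w ξ t

def Df15 (R : ℝ) (f : EuclideanSpace ℝ (Fin n) → ℝ → ℂ) : Prop :=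
  ∀ ξ t, R < ‖ξ‖ → 0 ≤ t → DifferentiableAt ℝ (fun η => f η t) ξ

noncomputable def pd15 (i : Fin n) (f : EuclideanSpace ℝ (Fin n) → ℝ → ℂ) :
    EuclideanSpace ℝ (Fin n) → ℝ → ℂ :=
  fun ξ t => pderiv15 i (fun η => f η t) ξ

def Sy15 (R : ℝ) : ℕ → ℤ → (EuclideanSpace ℝ (Fin n) → ℝ → ℝ) →
    (EuclideanSpace ℝ (Fin n) → ℝ → ℂ) → Prop
  | 0, m, w, f => Bd15 R m w f
  | N+1, m, w, f => Bd15 R m w f ∧ Df15 R f ∧ ∀ i, Sy15 R N (m-1) w (pd15 i f)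

variable {R : ℝ} {N : ℕ} {m m' k : ℤ} {w w' : EuclideanSpace ℝ (Fin n) → ℝ → ℝ}
  {f g : EuclideanSpace ℝ (Fin n) → ℝ → ℂ}

theorem Sy15.bd (h : Sy15 R N m w f) : Bd15 R m w f := by
  cases N with
  | zero => exact h
  | succ N => exact h.1

theorem Sy15.pred (h : Sy15 R (N+1) m w f) : Sy15 R N m w f := by
  induction N generalizing m f with
  | zero => exact h.1
  | succ N ih => exact ⟨h.1, h.2.1, fun i => ih (h.2.2 i)⟩

theorem Sy15.cast (h : Sy15 R N m w f) (e : m = m') : Sy15 R N m' w f := e ▸ h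

theorem evU15 {ξ : EuclideanSpace ℝ (Fin n)} (h : R < ‖ξ‖) :
    ∀ᶠ η in nhds ξ, R < ‖η‖ :=
  (isOpen_lt continuous_const continuous_norm).mem_nhds h

theorem evE15 {ξ : EuclideanSpace ℝ (Fin n)} {t : ℝ}
    (e : ∀ ξ t, R < ‖ξ‖ → 0 ≤ t → f ξ t = g ξ t) (h : R < ‖ξ‖) (ht : 0 ≤ t) :
    (fun η => f η t) =ᶠ[nhds ξ] (fun η => g η t) := by
  filter_upwards [evU15 h] with η hη using e η t hη ht

theorem Bd15.congr (h : Bd15 R m w f) (e : ∀ ξ t, R < ‖ξ‖ → 0 ≤ t → f ξ t = g ξ t) :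
    Bd15 R m w g := by
  obtain ⟨C, hC, h⟩ := h
  exact ⟨C, hC, fun ξ t h1 h2 => by rw [← e ξ t h1 h2]; exact h ξ t h1 h2⟩

theorem Sy15.congr (h : Sy15 R N m w f) (e : ∀ ξ t, R < ‖ξ‖ → 0 ≤ t → f ξ t = g ξ t) :
    Sy15 R N m w g := by
  induction N generalizing m f g with
  | zero => exact Bd15.congr h e
  | succ N ih =>
    refine ⟨h.1.congr e, fun ξ t h1 h2 => ?_, fun i => ih (h.2.2 i) ?_⟩
    · exact (h.2.1 ξ t h1 h2).congr_of_eventuallyEq (evE15 e h1 h2).symm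
    · intro ξ t h1 h2
      simp only [pd15, pderiv15, (evE15 e h1 h2).fderiv_eq]

theorem Sy15.mono (hR : 0 < R) (h : Sy15 R N m w f) (K : ℝ) (hK : 0 ≤ K)
    (hw : ∀ ξ t, R < ‖ξ‖ → 0 ≤ t → w ξ t ≤ K * ‖ξ‖ ^ k * w' ξ t) :
    Sy15 R N (m + k) w' f := by
  have key : ∀ m f, Bd15 R m w f → Bd15 R (m+k) w' f := by
    rintro m f ⟨C, hC, h⟩
    refine ⟨C * K, by positivity, fun ξ t h1 h2 => (h ξ t h1 h2).trans ?_⟩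
    have h0 : 0 < ‖ξ‖ := hR.trans h1
    calc C * ‖ξ‖ ^ m * w ξ t ≤ C * ‖ξ‖ ^ m * (K * ‖ξ‖ ^ k * w' ξ t) := by
          gcongr; exact hw ξ t h1 h2
      _ = _ := by rw [zpow_add₀ h0.ne']; ring
  induction N generalizing m f with
  | zero => exact key _ _ h
  | succ N ih => exact ⟨key _ _ h.1, h.2.1, fun i => (ih (h.2.2 i)).cast (by ring)⟩

theorem Bd15.add (hf : Bd15 R m w f) (hg : Bd15 R m w g) :
    Bd15 R m w (fun ξ t => f ξ t + g ξ t) := by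
  obtain ⟨C, hC, h⟩ := hf
  obtain ⟨C', hC', h'⟩ := hg
  refine ⟨C + C', by positivity, fun ξ t h1 h2 => (norm_add_le _ _).trans ?_⟩
  linarith [h ξ t h1 h2, h' ξ t h1 h2]

theorem Sy15.add (hf : Sy15 R N m w f) (hg : Sy15 R N m w g) :
    Sy15 R N m w (fun ξ t => f ξ t + g ξ t) := by
  induction N generalizing m f g with
  | zero => exact Bd15.add hf hg
  | succ N ih =>
    refine ⟨hf.1.add hg.1, fun ξ t h1 h2 => (hf.2.1 ξ t h1 h2).add (hg.2.1 ξ t h1 h2),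
      fun i => (ih (hf.2.2 i) (hg.2.2 i)).congr ?_⟩
    intro ξ t h1 h2
    simp only [pd15, pderiv15]
    rw [fderiv_fun_add (hf.2.1 ξ t h1 h2) (hg.2.1 ξ t h1 h2)]
    rfl

theorem Sy15.mul (hR : 0 < R) (hf : Sy15 R N m w f) (hg : Sy15 R N m' w' g) :
    Sy15 R N (m + m') (fun ξ t => w ξ t * w' ξ t) (fun ξ t => f ξ t * g ξ t) := by
  have key : ∀ m m' f g, Bd15 R m w f → Bd15 R m' w' g →
      Bd15 R (m+m') (fun ξ t => w ξ t * w' ξ t) (fun ξ t => f ξ t * g ξ t) := by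
    rintro m m' f g ⟨C, hC, h⟩ ⟨C', hC', h'⟩
    refine ⟨C * C', by positivity, fun ξ t h1 h2 => ?_⟩
    have h0 : 0 < ‖ξ‖ := hR.trans h1
    rw [norm_mul]
    calc _ ≤ (C * ‖ξ‖ ^ m * w ξ t) * (C' * ‖ξ‖ ^ m' * w' ξ t) :=
          mul_le_mul (h ξ t h1 h2) (h' ξ t h1 h2) (norm_nonneg _)
            ((norm_nonneg _).trans (h ξ t h1 h2))
      _ = _ := by rw [zpow_add₀ h0.ne']; ring
  induction N generalizing m m' f g with
  | zero => exact key _ _ _ _ hf hg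
  | succ N ih =>
    refine ⟨key _ _ _ _ hf.1 hg.1, fun ξ t h1 h2 => (hf.2.1 ξ t h1 h2).mul (hg.2.1 ξ t h1 h2),
      fun i => (((ih (hf.2.2 i) hg.pred).cast (by ring)).add
        ((ih hf.pred (hg.2.2 i)).cast (by ring))).congr ?_⟩
    intro ξ t h1 h2
    simp only [pd15, pderiv15]
    rw [fderiv_fun_mul (hf.2.1 ξ t h1 h2) (hg.2.1 ξ t h1 h2)]
    simp
    ring

theorem sy15_zero (_hR : 0 < R) (_hw : ∀ ξ t, 0 ≤ w ξ t) : Sy15 R N m w (fun _ _ => 0) := by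
  induction N generalizing m with
  | zero => exact ⟨0, le_rfl, fun ξ t _ _ => by simp⟩
  | succ N ih =>
    refine ⟨⟨0, le_rfl, fun ξ t _ _ => by simp⟩, fun ξ t _ _ => by fun_prop, fun i => ih.congr ?_⟩
    intro ξ t h1 h2
    simp [pd15, pderiv15]

theorem sy15_const (hR : 0 < R) (c : ℝ → ℂ) :
    Sy15 (n := n) R N 0 (fun _ t => ‖c t‖) (fun _ t => c t) := by
  have h : Bd15 (n := n) R 0 (fun _ t => ‖c t‖) (fun _ t => c t) :=
    ⟨1, by norm_num, fun ξ t _ _ => by simp⟩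
  cases N with
  | zero => exact h
  | succ N =>
    refine ⟨h, fun ξ t _ _ => by fun_prop,
      fun i => (sy15_zero hR (fun _ _ => norm_nonneg _)).congr ?_⟩
    intro ξ t h1 h2
    simp [pd15, pderiv15]

abbrev one15 : EuclideanSpace ℝ (Fin n) → ℝ → ℝ := fun _ _ => 1

theorem Sy15.mul1 (hR : 0 < R) (hf : Sy15 R N m one15 f) (hg : Sy15 R N m' w' g) :
    Sy15 R N (m + m') w' (fun ξ t => f ξ t * g ξ t) := by
  have := hf.mul hR hg
  simpa using this

theorem sy15_c (hR : 0 < R) (c : ℂ) :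
    Sy15 (n := n) R N 0 one15 (fun _ _ => c) :=
  ((sy15_const hR (fun _ => c)).mono (k := 0) (w' := one15) hR ‖c‖ (norm_nonneg _)
    (fun ξ t _ _ => by simp)).cast (by ring)

theorem Sy15.cmul (hR : 0 < R) (c : ℂ) (hf : Sy15 R N m w f) :
    Sy15 R N m w (fun ξ t => c * f ξ t) :=
  ((sy15_c hR c).mul1 hR hf).cast (by ring)

theorem Sy15.sub (hR : 0 < R) (hf : Sy15 R N m w f) (hg : Sy15 R N m w g) :
    Sy15 R N m w (fun ξ t => f ξ t - g ξ t) :=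
  (hf.add (hg.cmul hR (-1))).congr (fun ξ t _ _ => by ring)

theorem Sy15.tmul (hR : 0 < R) (hf : Sy15 R N m w f) :
    Sy15 R N m (fun ξ t => |t| * w ξ t) (fun ξ t => (t : ℂ) * f ξ t) := by
  have := ((sy15_const hR (fun t => (t : ℂ))).mul hR hf).cast (m' := m) (by ring)
  simpa using this

theorem sy15_coord (hR : 0 < R) (i : Fin n) :
    Sy15 R N 1 one15 (fun ξ _ => ((ξ i : ℝ) : ℂ)) := by
  have h : Bd15 R 1 one15 (fun ξ _ => ((ξ i : ℝ) : ℂ)) :=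
    ⟨1, by norm_num, fun ξ t _ _ => by simpa using PiLp.norm_apply_le ξ i⟩
  have hd : ∀ ξ : EuclideanSpace ℝ (Fin n), HasFDerivAt (fun η : EuclideanSpace ℝ (Fin n) => ((η i : ℝ) : ℂ))
      (Complex.ofRealCLM.comp (EuclideanSpace.proj (𝕜 := ℝ) i)) ξ := fun ξ =>
    (Complex.ofRealCLM.comp (EuclideanSpace.proj (𝕜 := ℝ) i)).hasFDerivAt
  cases N with
  | zero => exact h
  | succ N =>
    refine ⟨h, fun ξ t _ _ => (hd ξ).differentiableAt,
      fun j => (sy15_c hR ((((EuclideanSpace.single j 1 : EuclideanSpace ℝ (Fin n)) i : ℝ)) : ℂ)).congr ?_⟩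
    intro ξ t h1 h2
    simp only [pd15, pderiv15, (hd ξ).fderiv]
    rfl

theorem sy15_sum (hR : 0 < R) {ι : Type*} (s : Finset ι)
    (F : ι → EuclideanSpace ℝ (Fin n) → ℝ → ℂ) (h : ∀ i, Sy15 R N m one15 (F i)) :
    Sy15 R N m one15 (fun ξ t => ∑ i ∈ s, F i ξ t) := by
  classical
  induction s using Finset.induction_on with
  | empty => simpa using sy15_zero hR (w := one15) (fun _ _ => zero_le_one)
  | insert a s ha ih =>
    exact ((h a).add ih).congr (fun ξ t _ _ => by rw [Finset.sum_insert ha])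

theorem sy15_normsq (hR : 0 < R) :
    Sy15 (n := n) R N 2 one15 (fun ξ _ => ((‖ξ‖ ^ 2 : ℝ) : ℂ)) := by
  refine (sy15_sum hR Finset.univ _ (fun i =>
    ((sy15_coord hR i).mul1 hR (sy15_coord hR i)))).congr ?_
  intro ξ t _ _
  rw [EuclideanSpace.norm_sq_eq]
  simp [sq]

/-- inverse square roots -/
theorem sy15_invsqrt (hR : 0 < R) (D : EuclideanSpace ℝ (Fin n) → ℝ) (c : ℝ) (hc : 0 < c) (m : ℤ)
    (hD : ∀ N, Sy15 R N (2 * m) one15 (fun ξ _ => (D ξ : ℂ)))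
    (hl : ∀ ξ, R < ‖ξ‖ → c * ‖ξ‖ ^ (2 * m) ≤ D ξ) :
    Sy15 R N (-m) one15 (fun ξ _ => (((√(D ξ))⁻¹ : ℝ) : ℂ)) := by
  have hpos : ∀ ξ, R < ‖ξ‖ → 0 < D ξ := fun ξ h1 => by
    have h0 : 0 < ‖ξ‖ := hR.trans h1
    exact lt_of_lt_of_le (by positivity) (hl ξ h1)
  have hb : Bd15 R (-m) one15 (fun ξ _ => (((√(D ξ))⁻¹ : ℝ) : ℂ)) := by
    refine ⟨(√c)⁻¹, by positivity, fun ξ t h1 _ => ?_⟩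
    have h0 : 0 < ‖ξ‖ := hR.trans h1
    have hs : √c * ‖ξ‖ ^ m ≤ √(D ξ) := by
      apply Real.le_sqrt_of_sq_le
      rw [mul_pow, Real.sq_sqrt hc.le, ← zpow_natCast, ← zpow_mul, mul_comm m]
      exact hl ξ h1
    rw [Complex.norm_real, Real.norm_of_nonneg (by positivity), zpow_neg, ← mul_inv, mul_one]
    exact inv_anti₀ (by positivity) hs
  have hd : ∀ ξ, R < ‖ξ‖ → HasFDerivAt (fun η => (((√(D η))⁻¹ : ℝ) : ℂ))
      (((-(1/2) * (√(D ξ))⁻¹ ^ 3 : ℝ) : ℂ) • fderiv ℝ (fun η => (D η : ℂ)) ξ) ξ := by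
    intro ξ h1
    have hDd : DifferentiableAt ℝ (fun η => (D η : ℂ)) ξ := (hD 1).2.1 ξ 0 h1 le_rfl
    have hDr : DifferentiableAt ℝ D ξ := by
      have := Complex.reCLM.differentiableAt.comp ξ hDd
      exact this
    have h2 : HasFDerivAt (fun η => (D η : ℂ)) (Complex.ofRealCLM.comp (fderiv ℝ D ξ)) ξ :=
      Complex.ofRealCLM.hasFDerivAt.comp ξ hDr.hasFDerivAt
    have hp := hpos ξ h1
    have hsp : 0 < √(D ξ) := Real.sqrt_pos.2 hp
    have h3 : HasDerivAt (fun x : ℝ => (√x)⁻¹) (-(1/2) * (√(D ξ))⁻¹ ^ 3) (D ξ) := by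
      have := (Real.hasDerivAt_sqrt hp.ne').inv hsp.ne'
      refine this.congr_deriv ?_
      field_simp
    have h4 := Complex.ofRealCLM.hasFDerivAt.comp ξ (h3.comp_hasFDerivAt ξ hDr.hasFDerivAt)
    rw [h2.fderiv]
    refine HasFDerivAt.congr_fderiv h4 ?_
    ext v
    simp
  induction N with
  | zero => exact hb
  | succ N ih =>
    refine ⟨hb, fun ξ t h1 _ => (hd ξ h1).differentiableAt, fun i => ?_⟩
    have h3 := (ih.mul1 hR (ih.mul1 hR ih)).cmul hR (-(1/2))
    refine ((h3.mul1 hR ((hD (N+1)).2.2 i)).cast (by ring)).congr ?_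
    intro ξ t h1 _
    simp only [pd15, pderiv15]
    rw [(hd ξ h1).fderiv]
    simp
    left
    ring

noncomputable abbrev W15 (k : ℤ) (c : ℝ) : EuclideanSpace ℝ (Fin n) → ℝ → ℝ :=
  fun ξ t => Real.exp (-(c * t * ‖ξ‖ ^ k))

theorem Sy15.absorb (hR : 0 < R) {c c' : ℝ} (hc : c < c') (hf : Sy15 R N m (W15 k c') f) :
    Sy15 R N (m - k) (W15 k c) (fun ξ t => (t : ℂ) * f ξ t) := by
  refine ((hf.tmul hR).mono (k := -k) (w' := W15 k c) hR (c' - c)⁻¹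
    (inv_nonneg.2 (sub_pos.2 hc).le) ?_).cast (by ring)
  intro ξ t h1 h2
  have h0 : 0 < ‖ξ‖ := hR.trans h1
  have hx : 0 < ‖ξ‖ ^ k := by positivity
  have hcc := sub_pos.2 hc
  rw [zpow_neg, abs_of_nonneg h2]
  simp only [W15]
  set x := ‖ξ‖ ^ k
  have h3 : (c' - c) * t * x ≤ Real.exp ((c' - c) * t * x) := by
    linarith [Real.add_one_le_exp ((c' - c) * t * x)]
  have h4 : t ≤ (c' - c)⁻¹ * x⁻¹ * Real.exp ((c' - c) * t * x) := by
    rw [← mul_inv, inv_mul_eq_div, le_div_iff₀ (by positivity)]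
    linarith
  calc t * Real.exp (-(c' * t * x))
      ≤ ((c' - c)⁻¹ * x⁻¹ * Real.exp ((c' - c) * t * x)) * Real.exp (-(c' * t * x)) := by gcongr
    _ = (c' - c)⁻¹ * x⁻¹ * Real.exp (-(c * t * x)) := by
      rw [mul_assoc, ← Real.exp_add]; congr 2; ring

theorem sy15_W_mono (hR : 0 < R) {c c' : ℝ} (hc : c ≤ c') (hf : Sy15 R N m (W15 k c') f) :
    Sy15 R N m (W15 k c) f := by
  refine (hf.mono (k := 0) (w' := W15 k c) hR 1 zero_le_one ?_).cast (by ring)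
  intro ξ t h1 h2
  have h0 : 0 < ‖ξ‖ := hR.trans h1
  simp only [W15, zpow_zero, one_mul]
  gcongr

theorem pd_exp15 (a : EuclideanSpace ℝ (Fin n) → ℂ) (ξ : EuclideanSpace ℝ (Fin n)) (t : ℝ)
    (h : DifferentiableAt ℝ a ξ) :
    HasFDerivAt (fun η => exp (a η * t)) (exp (a ξ * t) • ((t : ℂ) • fderiv ℝ a ξ)) ξ := by
  have := (h.hasFDerivAt.mul_const (t : ℂ)).cexp
  exact this

theorem sy15_exp (hR : 0 < R) (a : EuclideanSpace ℝ (Fin n) → ℂ) (c0 : ℝ)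
    (ha : ∀ N, Sy15 R N k one15 (fun ξ _ => a ξ))
    (hl : ∀ ξ, R < ‖ξ‖ → (a ξ).re ≤ - c0 * ‖ξ‖ ^ k) (c : ℝ) (hc : c < c0) :
    Sy15 R N 0 (W15 k c) (fun ξ t => exp (a ξ * t)) := by
  have hb : Bd15 R 0 (W15 k c0) (fun ξ t => exp (a ξ * t)) := by
    refine ⟨1, zero_le_one, fun ξ t h1 h2 => ?_⟩
    simp only [Complex.norm_exp, zpow_zero, one_mul, W15]
    gcongr
    simp
    nlinarith [hl ξ h1]
  have hb' : ∀ c < c0, Bd15 R 0 (W15 k c) (fun ξ t => exp (a ξ * t)) := fun c hc =>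
    (sy15_W_mono (N := 0) hR hc.le hb)
  have hd : ∀ ξ, R < ‖ξ‖ → DifferentiableAt ℝ a ξ := fun ξ h => (ha 1).2.1 ξ 0 h le_rfl
  induction N generalizing c with
  | zero => exact hb' c hc
  | succ N ih =>
    refine ⟨hb' c hc, fun ξ t h1 _ => (pd_exp15 a ξ t (hd ξ h1)).differentiableAt, fun i => ?_⟩
    have h1 := ih ((c + c0)/2) (by linarith)
    refine ((((ha (N+1)).2.2 i).mul1 hR (h1.absorb (c := c) hR (by linarith))).cast
      (by ring)).congr ?_
    intro ξ t h1 _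
    simp only [pd15, pderiv15]
    rw [(pd_exp15 a ξ t (hd ξ h1)).fderiv]
    simp
    ring

theorem exp_diff15 (z w : ℂ) (M : ℝ) (hz : z.re ≤ M) (hw : w.re ≤ M) :
    ‖exp z - exp w‖ ≤ ‖z - w‖ * Real.exp M := by
  rw [mul_comm]
  refine Convex.norm_image_sub_le_of_norm_hasDerivWithin_le (f := exp) (f' := exp)
    (s := {z : ℂ | z.re ≤ M}) (fun x _ => (Complex.hasDerivAt_exp x).hasDerivWithinAt) ?_
    (convex_halfSpace_re_le M) hw hz
  intro x hx
  rw [Complex.norm_exp]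
  exact Real.exp_le_exp.2 hx

theorem sy15_expdiff (hR : 0 < R) (a b : EuclideanSpace ℝ (Fin n) → ℂ) (c0 : ℝ)
    (ha : ∀ N, Sy15 R N k one15 (fun ξ _ => a ξ))
    (hb : ∀ N, Sy15 R N k one15 (fun ξ _ => b ξ))
    (hab : ∀ N, Sy15 R N (k - 2) one15 (fun ξ _ => a ξ - b ξ))
    (hla : ∀ ξ, R < ‖ξ‖ → (a ξ).re ≤ - c0 * ‖ξ‖ ^ k)
    (hlb : ∀ ξ, R < ‖ξ‖ → (b ξ).re ≤ - c0 * ‖ξ‖ ^ k) (c : ℝ) (hc : c < c0) :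
    Sy15 R N (-2) (W15 k c) (fun ξ t => exp (a ξ * t) - exp (b ξ * t)) := by
  have hB : Bd15 R (k-2) (fun ξ t => |t| * W15 k c0 ξ t)
      (fun ξ t => exp (a ξ * t) - exp (b ξ * t)) := by
    obtain ⟨C, hC, h⟩ := hab 0
    refine ⟨C, hC, fun ξ t h1 h2 => ?_⟩
    have h3 := exp_diff15 (a ξ * t) (b ξ * t) (-(c0 * t * ‖ξ‖ ^ k))
      (by simp; nlinarith [hla ξ h1]) (by simp; nlinarith [hlb ξ h1])
    refine h3.trans ?_
    rw [← sub_mul, norm_mul, Complex.norm_real, Real.norm_eq_abs]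
    have h4 := h ξ t h1 h2
    rw [mul_one] at h4
    calc _ ≤ (C * ‖ξ‖ ^ (k-2)) * |t| * Real.exp (-(c0 * t * ‖ξ‖ ^ k)) := by gcongr
      _ = _ := by simp only [W15]; ring
  have hb' : ∀ c < c0, Bd15 R (-2) (W15 k c) (fun ξ t => exp (a ξ * t) - exp (b ξ * t)) := by
    intro c hc
    obtain ⟨C, hC, h⟩ := hB
    have h2 : Bd15 (n := n) R 0 (W15 k c0) (fun ξ t => (W15 k c0 ξ t : ℂ)) :=
      ⟨1, zero_le_one, fun ξ t _ _ => by
        rw [Complex.norm_real, Real.norm_of_nonneg (Real.exp_pos _).le]; simp⟩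
    obtain ⟨C', hC', h'⟩ := Sy15.absorb (N := 0) hR hc h2
    refine ⟨C * C', by positivity, fun ξ t h1 h2 => (h ξ t h1 h2).trans ?_⟩
    have h0 : 0 < ‖ξ‖ := hR.trans h1
    have h5 := h' ξ t h1 h2
    rw [norm_mul, Complex.norm_real, Complex.norm_real, Real.norm_eq_abs,
      Real.norm_of_nonneg (Real.exp_pos _).le] at h5
    calc _ ≤ C * ‖ξ‖ ^ (k-2) * (C' * ‖ξ‖ ^ (0 - k) * W15 k c ξ t) := by gcongr
      _ = C * C' * (‖ξ‖ ^ (k-2) * ‖ξ‖ ^ (0 - k)) * W15 k c ξ t := by ring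
      _ = _ := by rw [← zpow_add₀ h0.ne']; congr 3; ring
  have hd : ∀ ξ, R < ‖ξ‖ → DifferentiableAt ℝ a ξ := fun ξ h => (ha 1).2.1 ξ 0 h le_rfl
  have hd' : ∀ ξ, R < ‖ξ‖ → DifferentiableAt ℝ b ξ := fun ξ h => (hb 1).2.1 ξ 0 h le_rfl
  induction N generalizing c with
  | zero => exact hb' c hc
  | succ N ih =>
    refine ⟨hb' c hc, fun ξ t h1 _ => ((pd_exp15 a ξ t (hd ξ h1)).sub
      (pd_exp15 b ξ t (hd' ξ h1))).differentiableAt, fun i => ?_⟩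
    have h1 := ih ((c + c0)/2) (by linarith)
    have h2 := sy15_exp (N := N) hR a c0 ha hla ((c + c0)/2) (by linarith)
    refine ((((((hab (N+1)).2.2 i).mul1 hR (h2.absorb (c := c) hR (by linarith)))).cast
      (m' := -2 - 1) (by ring)).add
      (((((hb (N+1)).2.2 i).mul1 hR (h1.absorb (c := c) hR (by linarith)))).cast
      (m' := -2 - 1) (by ring))).congr ?_
    intro ξ t h1 _
    simp only [pd15, pderiv15]
    rw [((pd_exp15 a ξ t (hd ξ h1)).fun_sub (pd_exp15 b ξ t (hd' ξ h1))).fderiv,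
      fderiv_fun_sub (hd ξ h1) (hd' ξ h1)]
    simp
    ring

theorem Sy15.iter (i : Fin n) (j : ℕ) (h : Sy15 R (N + j) m w f) :
    Sy15 R N (m - j) w (fun ξ t => (pderiv15 i)^[j] (fun η => f η t) ξ) := by
  induction j generalizing m f with
  | zero => simpa using h
  | succ j ih =>
    have := ih (h.2.2 i)
    refine this.cast (by push_cast; ring)

theorem Sy15.mder (α : Fin n → ℕ) (l : List (Fin n)) (h : Sy15 R (N + (l.map α).sum) m w f) :
    Sy15 R N (m - ((l.map α).sum : ℕ)) w
      (fun ξ t => l.foldr (fun i g => (pderiv15 i)^[α i] g) (fun η => f η t) ξ) := by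
  induction l generalizing N with
  | nil => simpa using h
  | cons i l ih =>
    have h' : Sy15 R ((N + α i) + (l.map α).sum) m w f := by
      have e : N + α i + (l.map α).sum = N + ((i :: l).map α).sum := by simp; ring
      rw [e]; exact h
    exact ((ih h').iter i (α i)).cast (by simp; ring)

theorem Sy15.fin (_hR : 0 < R) (α : Fin n → ℕ) (h : ∀ N, Sy15 R N m w f) :
    ∃ C : ℝ, 0 ≤ C ∧ ∀ ξ t, R < ‖ξ‖ → 0 ≤ t →
      ‖mderiv15 α (fun η => f η t) ξ‖ ≤ C * ‖ξ‖ ^ (-(((∑ i, α i : ℕ) : ℝ) - m)) * w ξ t := by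
  obtain ⟨C, hC, h⟩ := ((h (0 + ((List.finRange n).map α).sum)).mder α (List.finRange n)).bd
  refine ⟨C, hC, fun ξ t h1 h2 => (h ξ t h1 h2).trans (le_of_eq ?_)⟩
  have e : ((List.finRange n).map α).sum = ∑ i, α i := by
    rw [← List.ofFn_eq_map, List.sum_ofFn]
  rw [e, ← Real.rpow_intCast]
  congr 3
  push_cast
  ring

end helpers

section helpers2

theorem alg15 {ν x s : ℝ} (hν : 0 < ν) (hx : 3 / ν < x) (hs : s = √(ν^2 * x^4 - 4 * x^2)) :
    0 < x ∧ (ν^2 / 2) * x^4 ≤ ν^2 * x^4 - 4 * x^2 ∧ 0 < s ∧ s^2 = ν^2 * x^4 - 4 * x^2 ∧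
      s ≤ ν * x^2 := by
  have h0 : 0 < x := lt_trans (by positivity) hx
  have h1 : 3 < ν * x := by rwa [div_lt_iff₀' hν] at hx
  have h2 : 9 ≤ ν^2 * x^2 := by nlinarith
  have h3 : (ν^2 / 2) * x^4 ≤ ν^2 * x^4 - 4 * x^2 := by
    have : 0 < x^2 := by positivity
    nlinarith
  have h4 : 0 < ν^2 * x^4 - 4 * x^2 := lt_of_lt_of_le (by positivity) h3
  refine ⟨h0, h3, hs ▸ Real.sqrt_pos.2 h4, by rw [hs, Real.sq_sqrt h4.le], ?_⟩
  rw [hs]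
  apply Real.sqrt_le_iff.2
  constructor
  · positivity
  · nlinarith [sq_nonneg x]

noncomputable abbrev s15 {n : ℕ} (ν : ℝ) (ξ : EuclideanSpace ℝ (Fin n)) : ℝ :=
  √(ν^2 * ‖ξ‖^4 - 4 * ‖ξ‖^2)
noncomputable abbrev Lp15 {n : ℕ} (ν : ℝ) (ξ : EuclideanSpace ℝ (Fin n)) : ℝ :=
  -(1/2) * (ν * ‖ξ‖^2 - s15 ν ξ)
noncomputable abbrev Lm15 {n : ℕ} (ν : ℝ) (ξ : EuclideanSpace ℝ (Fin n)) : ℝ :=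
  -(1/2) * (ν * ‖ξ‖^2 + s15 ν ξ)

variable {n : ℕ}

theorem sdisc_eq15 {ν : ℝ} (hν : 0 < ν) {ξ : EuclideanSpace ℝ (Fin n)} (h : 3 / ν < ‖ξ‖) :
    sdisc15 ν ξ = (s15 ν ξ : ℂ) := by
  obtain ⟨h0, h3, h4, h5, h6⟩ := alg15 hν h rfl
  have : 0 ≤ ν^2 * ‖ξ‖^4 - 4 * ‖ξ‖^2 := le_trans (by positivity) h3
  rw [sdisc15, s15, Real.sqrt_eq_rpow, Complex.ofReal_cpow this]
  norm_num

theorem lamP_eq15 {ν : ℝ} (hν : 0 < ν) {ξ : EuclideanSpace ℝ (Fin n)} (h : 3 / ν < ‖ξ‖) :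
    lamP15 ν ξ = (Lp15 ν ξ : ℂ) := by
  rw [lamP15, sdisc_eq15 hν h]; push_cast; ring

theorem lamM_eq15 {ν : ℝ} (hν : 0 < ν) {ξ : EuclideanSpace ℝ (Fin n)} (h : 3 / ν < ‖ξ‖) :
    lamM15 ν ξ = (Lm15 ν ξ : ℂ) := by
  rw [lamM15, sdisc_eq15 hν h]; push_cast; ring

theorem main15 (ν : ℝ) (hν : 0 < ν) (N : ℕ) :
    let w : EuclideanSpace ℝ (Fin n) → ℝ → ℝ :=
      fun ξ t => Real.exp (-t/(2*ν)) + Real.exp (-(ν/4) * ‖ξ‖^2 * t)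
    Sy15 (3/ν) N (-1) w (fun ξ t => Ghat15 ν ξ t 0 1) ∧
    Sy15 (3/ν) N (-2) w (fun ξ t => Ghat15 ν ξ t 0 0 - exp (-(t/ν : ℝ))) ∧
    Sy15 (3/ν) N (-2) w (fun ξ t => Ghat15 ν ξ t 1 1 - exp (-(ν * ‖ξ‖^2 * t : ℝ))) := by
  intro w
  have hR : 0 < 3 / ν := by positivity
  have hX : ∀ N, Sy15 (n := n) (3/ν) N 2 one15 (fun ξ _ => ((‖ξ‖ ^ 2 : ℝ) : ℂ)) :=
    fun N => sy15_normsq hR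
  have hD : ∀ N, Sy15 (n := n) (3/ν) N 4 one15
      (fun ξ _ => ((ν^2 * ‖ξ‖^4 - 4 * ‖ξ‖^2 : ℝ) : ℂ)) := by
    intro N
    have h1 : Sy15 (n := n) (3/ν) N 4 one15 (fun ξ _ => ((‖ξ‖ ^ 2 : ℝ) : ℂ)) := by
      refine ((hX N).mono (k := 2) (w' := one15) hR (ν^2) (by positivity) ?_).cast (by norm_num)
      intro ξ t h1 _
      have h1 : 3 < ν * ‖ξ‖ := by rwa [div_lt_iff₀' hν] at h1
      simp only [one15, mul_one]
      norm_cast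
      nlinarith
    refine (((((hX N).mul1 hR (hX N)).cast (m' := 4) (by norm_num)).cmul hR ((ν^2 : ℝ) : ℂ)).sub hR
      (h1.cmul hR 4)).congr ?_
    intro ξ t _ _
    push_cast
    ring
  have hq : ∀ N, Sy15 (n := n) (3/ν) N (-2) one15 (fun ξ _ => (((s15 ν ξ)⁻¹ : ℝ) : ℂ)) := by
    intro N
    refine sy15_invsqrt hR _ (ν^2/2) (by positivity) 2 hD ?_
    intro ξ h
    have := (alg15 hν h rfl).2.1
    norm_num
    norm_cast
  have hs : ∀ N, Sy15 (n := n) (3/ν) N 2 one15 (fun ξ _ => ((s15 ν ξ : ℝ) : ℂ)) := by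
    intro N
    refine (((hD N).mul1 hR (hq N)).cast (by norm_num)).congr ?_
    intro ξ t h _
    obtain ⟨h0, h3, h4, h5, h6⟩ := alg15 hν h rfl
    rw [← h5]
    norm_cast
    change s15 ν ξ ^ 2 * (s15 ν ξ)⁻¹ = s15 ν ξ
    have : s15 ν ξ ≠ 0 := h4.ne'
    field_simp
  have hP : ∀ N, Sy15 (n := n) (3/ν) N 2 one15 (fun ξ _ => ((ν * ‖ξ‖^2 + s15 ν ξ : ℝ) : ℂ)) := by
    intro N
    refine (((hX N).cmul hR (ν : ℂ)).add (hs N)).congr ?_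
    intro ξ t _ _
    push_cast
    ring
  have hp : ∀ N, Sy15 (n := n) (3/ν) N (-1) one15
      (fun ξ _ => (((√(ν * ‖ξ‖^2 + s15 ν ξ))⁻¹ : ℝ) : ℂ)) := by
    intro N
    refine sy15_invsqrt hR _ ν hν 1 hP ?_
    intro ξ h
    obtain ⟨h0, h3, h4, h5, h6⟩ := alg15 hν h rfl
    rw [mul_one]
    norm_cast
    linarith
  have hiX : ∀ N, Sy15 (n := n) (3/ν) N (-1) one15 (fun ξ _ => ((‖ξ‖⁻¹ : ℝ) : ℂ)) := by
    intro N
    refine (sy15_invsqrt hR (fun ξ => ‖ξ‖^2) 1 one_pos 1 hX ?_).congr ?_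
    · intro ξ h
      rw [mul_one, one_mul]
      norm_cast
    · intro ξ t _ _
      rw [Real.sqrt_sq (norm_nonneg _)]
  have hx : ∀ N, Sy15 (n := n) (3/ν) N 1 one15 (fun ξ _ => (‖ξ‖ : ℂ)) := by
    intro N
    refine (((hX N).mul1 hR (hiX N)).cast (by norm_num)).congr ?_
    intro ξ t h _
    have h0 := (alg15 hν h rfl).1
    norm_cast
    field_simp
  have eLp : ∀ ξ : EuclideanSpace ℝ (Fin n), 3/ν < ‖ξ‖ →
      Lp15 ν ξ = -2 * (‖ξ‖^2 * (ν * ‖ξ‖^2 + s15 ν ξ)⁻¹) := by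
    intro ξ h
    obtain ⟨h0, h3, h4, h5, h6⟩ := alg15 hν h rfl
    have : 0 < ν * ‖ξ‖^2 + s15 ν ξ := by positivity
    simp only [Lp15]
    field_simp
    simp only [s15]
    linear_combination h5
  have hLp : ∀ N, Sy15 (n := n) (3/ν) N 0 one15 (fun ξ _ => (Lp15 ν ξ : ℂ)) := by
    intro N
    refine ((((hX N).mul1 hR ((hp N).mul1 hR (hp N))).cmul hR (-2)).cast (by norm_num)).congr ?_
    intro ξ t h _
    obtain ⟨h0, h3, h4, h5, h6⟩ := alg15 hν h rfl
    rw [eLp ξ h]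
    have : 0 ≤ ν * ‖ξ‖^2 + s15 ν ξ := by positivity
    rw [← Complex.ofReal_mul, ← mul_inv, Real.mul_self_sqrt this]
    push_cast
    ring
  have hLp2 : ∀ N, Sy15 (n := n) (3/ν) N (0 - 2) one15
      (fun ξ _ => (Lp15 ν ξ : ℂ) - (-(1/ν) : ℝ)) := by
    intro N
    refine (((((hLp N).mul1 hR (hiX N)).mul1 hR ((hLp N).mul1 hR (hiX N))).cmul hR
      ((-(1/ν) : ℝ) : ℂ)).cast (by norm_num)).congr ?_
    intro ξ t h _
    obtain ⟨h0, h3, h4, h5, h6⟩ := alg15 hν h rfl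
    norm_cast
    simp only [Lp15]
    field_simp
    simp only [s15]
    linear_combination (-1) * h5
  have hLm : ∀ N, Sy15 (n := n) (3/ν) N 2 one15 (fun ξ _ => (Lm15 ν ξ : ℂ)) := by
    intro N
    refine ((hP N).cmul hR (-(1/2))).congr ?_
    intro ξ t h _
    push_cast
    ring
  have hB : ∀ N, Sy15 (n := n) (3/ν) N 2 one15 (fun ξ _ => ((-(ν * ‖ξ‖^2) : ℝ) : ℂ)) := by
    intro N
    refine ((hX N).cmul hR (-ν)).congr ?_
    intro ξ t h _
    push_cast
    ring
  have hLm2 : ∀ N, Sy15 (n := n) (3/ν) N (2 - 2) one15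
      (fun ξ _ => (Lm15 ν ξ : ℂ) - ((-(ν * ‖ξ‖^2) : ℝ) : ℂ)) := by
    intro N
    refine ((hLp N).cmul hR (-1)).congr ?_
    intro ξ t h _
    push_cast
    ring
  have bLp : ∀ ξ : EuclideanSpace ℝ (Fin n), 3/ν < ‖ξ‖ →
      ((Lp15 ν ξ : ℂ)).re ≤ - (1/ν) * ‖ξ‖ ^ (0:ℤ) := by
    intro ξ h
    obtain ⟨h0, h3, h4, h5, h6⟩ := alg15 hν h rfl
    rw [Complex.ofReal_re, eLp ξ h]
    have : 0 < ν * ‖ξ‖^2 + s15 ν ξ := by positivity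
    have h7 : 1/ν ≤ 2 * ‖ξ‖^2 / (ν * ‖ξ‖^2 + s15 ν ξ) := by
      rw [div_le_div_iff₀ hν this]
      simp only [s15]
      linarith
    simp only [zpow_zero, mul_one]
    calc _ = -(2 * ‖ξ‖^2 / (ν * ‖ξ‖^2 + s15 ν ξ)) := by ring
      _ ≤ _ := by linarith
  have bb1 : ∀ ξ : EuclideanSpace ℝ (Fin n), 3/ν < ‖ξ‖ →
      (((-(1/ν) : ℝ) : ℂ)).re ≤ - (1/ν) * ‖ξ‖ ^ (0:ℤ) := by
    intro ξ h
    rw [Complex.ofReal_re]; simp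
  have bLm : ∀ ξ : EuclideanSpace ℝ (Fin n), 3/ν < ‖ξ‖ →
      ((Lm15 ν ξ : ℂ)).re ≤ - (ν/2) * ‖ξ‖ ^ (2:ℤ) := by
    intro ξ h
    obtain ⟨h0, h3, h4, h5, h6⟩ := alg15 hν h rfl
    rw [Complex.ofReal_re]
    norm_cast
    simp only [Lm15, s15]
    linarith
  have bb2 : ∀ ξ : EuclideanSpace ℝ (Fin n), 3/ν < ‖ξ‖ →
      (((-(ν * ‖ξ‖^2) : ℝ) : ℂ)).re ≤ - (ν/2) * ‖ξ‖ ^ (2:ℤ) := by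
    intro ξ h
    rw [Complex.ofReal_re]
    norm_cast
    have : 0 ≤ ν * ‖ξ‖^2 := by positivity
    linarith
  have c1 : 1/(2*ν) < 1/ν := by
    rw [div_lt_div_iff₀ (by positivity) hν]; linarith
  have c2 : ν/4 < ν/2 := by linarith
  have toW1 : ∀ {m f}, Sy15 (n := n) (3/ν) N m (W15 0 (1/(2*ν))) f → Sy15 (3/ν) N m w f := by
    intro m f h
    refine (h.mono (k := 0) (w' := w) hR 1 zero_le_one ?_).cast (by ring)
    intro ξ t _ _
    simp only [W15, w, zpow_zero, one_mul, mul_one]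
    have e : -(1/(2*ν)*t) = -t/(2*ν) := by ring
    rw [e]
    linarith [Real.exp_pos (-(ν/4) * ‖ξ‖^2 * t)]
  have toW2 : ∀ {m f}, Sy15 (n := n) (3/ν) N m (W15 2 (ν/4)) f → Sy15 (3/ν) N m w f := by
    intro m f h
    refine (h.mono (k := 0) (w' := w) hR 1 zero_le_one ?_).cast (by ring)
    intro ξ t _ _
    simp only [W15, w, zpow_zero, one_mul]
    have e : -(ν/4*t*‖ξ‖^(2:ℤ)) = -(ν/4) * ‖ξ‖^2 * t := by norm_cast; ring
    rw [e]
    linarith [Real.exp_pos (-t/(2*ν))]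
  have e1 := toW1 (sy15_exp (N := N) hR (fun ξ => (Lp15 ν ξ : ℂ)) (1/ν) hLp bLp _ c1)
  have e2 := toW2 (sy15_exp (N := N) hR (fun ξ => (Lm15 ν ξ : ℂ)) (ν/2) hLm bLm _ c2)
  have d1 := toW1 (sy15_expdiff (N := N) hR (fun ξ => (Lp15 ν ξ : ℂ)) (fun ξ => ((-(1/ν) : ℝ) : ℂ))
    (1/ν) hLp (fun N => sy15_c hR _) hLp2 bLp bb1 _ c1)
  have d2 := toW2 (sy15_expdiff (N := N) hR (fun ξ => (Lm15 ν ξ : ℂ))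
    (fun ξ => ((-(ν * ‖ξ‖^2) : ℝ) : ℂ)) (ν/2) hLm hB hLm2 bLm bb2 _ c2)
  have dd := e1.sub hR e2
  have hr := (hLp N).mul1 hR (hq N)
  have hrd := ((hr.mul1 hR dd).cast (m' := -2) (by norm_num))
  have hsub : ∀ ξ : EuclideanSpace ℝ (Fin n), (Lp15 ν ξ : ℂ) - (Lm15 ν ξ : ℂ) = (s15 ν ξ : ℂ) := by
    intro ξ; push_cast; ring
  refine ⟨?_, ?_, ?_⟩
  · refine (((((hx N).mul1 hR (hq N)).cmul hR (-1)).mul1 hR dd).cast (by norm_num)).congr ?_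
    intro ξ t h _
    simp only [Ghat15, lamP_eq15 hν h, lamM_eq15 hν h, hsub]
    simp only [Matrix.of_apply, Matrix.cons_val', Matrix.cons_val_zero, Matrix.cons_val_one,
      Matrix.cons_val_fin_one, Complex.ofReal_inv]
    ring
  · refine ((hrd.cmul hR (-1)).add d1).congr ?_
    intro ξ t h _
    have h4 : (s15 ν ξ : ℂ) ≠ 0 := by exact_mod_cast (alg15 hν h rfl).2.2.1.ne'
    have e : ((-(1/ν) : ℝ) : ℂ) * t = -((t/ν : ℝ) : ℂ) := by push_cast; ring
    have hm : (Lm15 ν ξ : ℂ) = Lp15 ν ξ - s15 ν ξ := by rw [← hsub]; ring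
    simp only [Ghat15, lamP_eq15 hν h, lamM_eq15 hν h, hsub, e]
    simp only [Matrix.of_apply, Matrix.cons_val', Matrix.cons_val_zero, Matrix.cons_val_one,
      Matrix.cons_val_fin_one, Complex.ofReal_inv]
    generalize exp ((Lp15 ν ξ : ℂ) * t) = A
    generalize exp ((Lm15 ν ξ : ℂ) * t) = B
    rw [hm]
    field_simp
    ring
  · refine (hrd.add d2).congr ?_
    intro ξ t h _
    have h4 : (s15 ν ξ : ℂ) ≠ 0 := by exact_mod_cast (alg15 hν h rfl).2.2.1.ne'
    have e : ((-(ν * ‖ξ‖^2) : ℝ) : ℂ) * t = -((ν * ‖ξ‖^2 * t : ℝ) : ℂ) := by push_cast; ring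
    have hm : (Lm15 ν ξ : ℂ) = Lp15 ν ξ - s15 ν ξ := by rw [← hsub]; ring
    simp only [Ghat15, lamP_eq15 hν h, lamM_eq15 hν h, hsub, e]
    simp only [Matrix.of_apply, Matrix.cons_val', Matrix.cons_val_zero, Matrix.cons_val_one,
      Matrix.cons_val_fin_one, Complex.ofReal_inv]
    generalize exp ((Lp15 ν ξ : ℂ) * t) = A
    generalize exp ((Lm15 ν ξ : ℂ) * t) = B
    rw [hm]
    field_simp
    ring

end helpers2

/-- high-frequency expansion of the Green matrix: there exist
`R, ϑ > 0` depending on `ν̄` such that for `|ξ| ≥ R`,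
`𝒢̂(ξ,t) = e^{−t/ν̄}diag(1,0) + e^{−ν̄|ξ|²t}diag(0,1) + 𝒢̂¹(ξ,t)[[0,1],[1,0]] + 𝒢̂²(ξ,t)`
with `𝒢̂²` diagonal, and for every multi-index `α`,
`|∂^α_ξ𝒢̂¹| ≤ C|ξ|^{−|α|−1}(e^{−t/(2ν̄)} + e^{−ϑ|ξ|²t})`,
`|∂^α_ξ𝒢̂²| ≤ C|ξ|^{−|α|−2}(e^{−t/(2ν̄)} + e^{−ϑ|ξ|²t})`. -/
theorem statement15 {n : ℕ} (ν : ℝ) (hν : 0 < ν) :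
    ∃ R ϑ : ℝ, 0 < R ∧ 0 < ϑ ∧
    ∃ G1 : EuclideanSpace ℝ (Fin n) → ℝ → ℂ,
    ∃ G2 : EuclideanSpace ℝ (Fin n) → ℝ → Matrix (Fin 2) (Fin 2) ℂ,
      (∀ (ξ : EuclideanSpace ℝ (Fin n)) (t : ℝ), R ≤ ‖ξ‖ → 0 ≤ t →
        Ghat15 ν ξ t
          = (exp (-(t/ν : ℝ)) : ℂ) • !![(1:ℂ), 0; 0, 0]
            + (exp (-(ν * ‖ξ‖^2 * t : ℝ)) : ℂ) • !![(0:ℂ), 0; 0, 1]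
            + G1 ξ t • !![(0:ℂ), 1; 1, 0]
            + G2 ξ t ∧
        (∀ i j : Fin 2, i ≠ j → G2 ξ t i j = 0)) ∧
      (∀ α : Fin n → ℕ, ∃ C : ℝ, 0 < C ∧
        ∀ (ξ : EuclideanSpace ℝ (Fin n)) (t : ℝ), R ≤ ‖ξ‖ → 0 ≤ t →
          ‖mderiv15 α (fun η => G1 η t) ξ‖
            ≤ C * ‖ξ‖ ^ (-(((∑ i, α i : ℕ) : ℝ) + 1))
              * (Real.exp (-t/(2*ν)) + Real.exp (-ϑ * ‖ξ‖^2 * t)) ∧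
          ∀ i j : Fin 2,
            ‖mderiv15 α (fun η => G2 η t i j) ξ‖
              ≤ C * ‖ξ‖ ^ (-(((∑ i, α i : ℕ) : ℝ) + 2))
                * (Real.exp (-t/(2*ν)) + Real.exp (-ϑ * ‖ξ‖^2 * t))) := by
  have hR : 0 < 3 / ν := by positivity
  have hlt : 3 / ν < 4 / ν := by
    rw [div_lt_div_iff₀ hν hν]; nlinarith
  refine ⟨4/ν, ν/4, by positivity, by positivity, fun ξ t => Ghat15 ν ξ t 0 1,
    fun ξ t => !![Ghat15 ν ξ t 0 0 - exp (-(t/ν : ℝ)), 0;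
      0, Ghat15 ν ξ t 1 1 - exp (-(ν * ‖ξ‖^2 * t : ℝ))], ?_, ?_⟩
  · intro ξ t _ _
    constructor
    · have hsym : Ghat15 ν ξ t 1 0 = Ghat15 ν ξ t 0 1 := by simp [Ghat15]
      ext i j
      fin_cases i <;> fin_cases j <;> simp [hsym]
    · intro i j hij
      fin_cases i <;> fin_cases j <;> simp at hij ⊢
  · intro α
    obtain ⟨C1, hC1, h1⟩ := Sy15.fin hR α (fun N => (main15 (n := n) ν hν N).1)
    obtain ⟨C2, hC2, h2⟩ := Sy15.fin hR α (fun N => (main15 (n := n) ν hν N).2.1)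
    obtain ⟨C3, hC3, h3⟩ := Sy15.fin hR α (fun N => (main15 (n := n) ν hν N).2.2)
    obtain ⟨C4, hC4, h4⟩ := Sy15.fin hR α (fun N => sy15_zero (n := n) (N := N) (m := -2)
      (w := fun ξ t => Real.exp (-t/(2*ν)) + Real.exp (-(ν/4) * ‖ξ‖^2 * t)) hR
      (fun ξ t => by positivity))
    refine ⟨C1 + C2 + C3 + C4 + 1, by positivity, fun ξ t hξ ht => ?_⟩
    have hξ' := hlt.trans_le hξ
    have up : ∀ {C a A B : ℝ}, C ≤ C1 + C2 + C3 + C4 + 1 → 0 ≤ A → 0 ≤ B → a ≤ C * A * B →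
        a ≤ (C1 + C2 + C3 + C4 + 1) * A * B := by
      intro C a A B hC hA hB h
      exact h.trans (by gcongr)
    have h1 := h1 ξ t hξ' ht
    have h2 := h2 ξ t hξ' ht
    have h3 := h3 ξ t hξ' ht
    have h4 := h4 ξ t hξ' ht
    simp only [Int.cast_neg, Int.cast_one, Int.cast_ofNat, sub_neg_eq_add] at h1 h2 h3 h4
    refine ⟨up (C := C1) (by linarith) (by positivity) (by positivity) h1, fun i j => ?_⟩
    fin_cases i <;> fin_cases j
    · exact up (C := C2) (by linarith) (by positivity) (by positivity) h2
    · exact up (C := C4) (by linarith) (by positivity) (by positivity) h4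
    · exact up (C := C4) (by linarith) (by positivity) (by positivity) h4
    · exact up (C := C3) (by linarith) (by positivity) (by positivity) h3
end
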